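/- arXiv:quant-ph/0604049 — 7 statements merged into one kernel-verified Lean document; each statement's English description precedes it below -/
import Mathlib

section
/- Every finite weighted 2-design of dimension d is a weighted 1-design: if x : ι → ℂ^d is a finite family of unit vectors with weights w : ι → ℝ, w i > 0, ∑_i w i = 1, satisfying ∑_i w i • (π(x i) ⊗ π(x i)) = (d(d+1))⁻¹ • (I⊗I + T), then ∑_i w i • π(x i) = d⁻¹ • I. -/
open scoped Kronecker
open Matrix

noncomputable def proj {d : ℕ} (v : EuclideanSpace ℂ (Fin d)) : Matrix (Fin d) (Fin d) ℂ :=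
  Matrix.of fun i j => v i * (starRingEnd ℂ) (v j)

noncomputable def swapMatrix (d : ℕ) : Matrix (Fin d × Fin d) (Fin d × Fin d) ℂ :=
  Matrix.of fun p q => if p.1 = q.2 ∧ p.2 = q.1 then 1 else 0

theorem sum_proj_diag {d : ℕ} {v : EuclideanSpace ℂ (Fin d)} (hv : ‖v‖ = 1) :
    ∑ k, proj v k k = 1 := by
  have h := EuclideanSpace.norm_sq_eq v
  rw [hv] at h
  simp only [proj, Matrix.of_apply, Complex.mul_conj']
  exact_mod_cast h.symm.trans (one_pow 2)

theorem sum_one_kronecker_add_swapMatrix (d : ℕ) (a b : Fin d) :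
    ∑ k, ((1 : Matrix (Fin d) (Fin d) ℂ) ⊗ₖ (1 : Matrix (Fin d) (Fin d) ℂ) + swapMatrix d)
      (a, k) (b, k) = ((d : ℂ) + 1) * (1 : Matrix (Fin d) (Fin d) ℂ) a b := by
  have hswap : ∑ k, swapMatrix d (a, k) (b, k) = (1 : Matrix (Fin d) (Fin d) ℂ) a b := by
    simp [swapMatrix, ite_and, Matrix.one_apply]
  have hone :
      ∑ k, ((1 : Matrix (Fin d) (Fin d) ℂ) ⊗ₖ (1 : Matrix (Fin d) (Fin d) ℂ)) (a, k) (b, k) =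
        d * (1 : Matrix (Fin d) (Fin d) ℂ) a b := by
    by_cases h : a = b <;> simp [kroneckerMap_apply, Matrix.one_apply, h]
  simp only [Matrix.add_apply, Finset.sum_add_distrib, hswap, hone]
  ring

theorem stmt2 {d : ℕ} (hd : 1 ≤ d) {ι : Type*} [Fintype ι]
    (x : ι → EuclideanSpace ℂ (Fin d)) (hx : ∀ i, ‖x i‖ = 1)
    (w : ι → ℝ) (hw : ∀ i, 0 < w i) (hw1 : ∑ i, w i = 1)
    (hdesign : ∑ i, w i • (proj (x i) ⊗ₖ proj (x i))
      = ((d : ℝ) * ((d : ℝ) + 1))⁻¹ •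
          ((1 : Matrix (Fin d) (Fin d) ℂ) ⊗ₖ (1 : Matrix (Fin d) (Fin d) ℂ) + swapMatrix d)) :
    ∑ i, w i • proj (x i) = (d : ℝ)⁻¹ • (1 : Matrix (Fin d) (Fin d) ℂ) := by
  have hd0 : (d : ℂ) ≠ 0 := Nat.cast_ne_zero.mpr (by omega)
  have hd1 : (d : ℂ) + 1 ≠ 0 := Nat.cast_add_one_ne_zero d
  ext a b
  have key := congrArg
    (fun M : Matrix (Fin d × Fin d) (Fin d × Fin d) ℂ => ∑ k, M (a, k) (b, k)) hdesign
  simp only [Matrix.sum_apply, Matrix.smul_apply, ← Finset.smul_sum] at key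
  rw [Finset.sum_comm, sum_one_kronecker_add_swapMatrix] at key
  simp only [kroneckerMap_apply, ← Finset.smul_sum, ← Finset.mul_sum, sum_proj_diag (hx _),
    mul_one] at key
  simp only [Matrix.sum_apply, Matrix.smul_apply]
  rw [key]
  simp only [Complex.real_smul]
  push_cast
  field_simp
end

section
/- Let (x, w) be a finite weighted 2-design of dimension d. Then every d×d complex matrix A can be reconstructed from the design projectors: A = d • ∑_i w i • ((d+1) · tr(π(x i) A) − tr A) • π(x i). -/
open scoped Kronecker
open Matrix

theorem trace_proj {d : ℕ} (v : EuclideanSpace ℂ (Fin d)) (hv : ‖v‖ = 1) :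
    ∑ a, proj v a a = 1 := by
  have h : ∑ a, ‖v a‖ ^ 2 = 1 := by rw [← EuclideanSpace.norm_sq_eq, hv, one_pow]
  simp only [proj, Matrix.of_apply, Complex.mul_conj']
  exact_mod_cast h

theorem stmt4 {d : ℕ} (hd : 1 ≤ d) {ι : Type*} [Fintype ι]
    (x : ι → EuclideanSpace ℂ (Fin d)) (hx : ∀ i, ‖x i‖ = 1)
    (w : ι → ℝ) (hw : ∀ i, 0 < w i) (hw1 : ∑ i, w i = 1)
    (hdesign : ∑ i, w i • (proj (x i) ⊗ₖ proj (x i))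
      = ((d : ℝ) * ((d : ℝ) + 1))⁻¹ •
          ((1 : Matrix (Fin d) (Fin d) ℂ) ⊗ₖ (1 : Matrix (Fin d) (Fin d) ℂ) + swapMatrix d))
    (A : Matrix (Fin d) (Fin d) ℂ) :
    A = (d : ℂ) • ∑ i, (w i : ℂ) •
        ((((d : ℂ) + 1) * Matrix.trace (proj (x i) * A) - Matrix.trace A) • proj (x i)) := by
  have hd0 : (d : ℂ) ≠ 0 := by exact_mod_cast (by omega : d ≠ 0)
  have hd1 : (d : ℂ) + 1 ≠ 0 := by exact_mod_cast d.succ_ne_zero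
  have entry : ∀ a b c e, ∑ i, (w i : ℂ) * (proj (x i) a b * proj (x i) c e)
      = ((d : ℂ) * (d + 1))⁻¹ *
        ((if a = b then 1 else 0) * (if c = e then 1 else 0)
          + if a = e ∧ c = b then 1 else 0) := by
    intro a b c e
    have h := congrFun (congrFun hdesign (a, c)) (b, e)
    by_cases hab : a = b <;> by_cases hce : c = e <;>
      simpa [Matrix.sum_apply, swapMatrix, Matrix.one_apply, hab, hce, mul_add] using h
  have marginal : ∀ c e, ∑ i, (w i : ℂ) * proj (x i) c e
      = (d : ℂ)⁻¹ * if c = e then 1 else 0 := by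
    intro c e
    calc ∑ i, (w i : ℂ) * proj (x i) c e
        = ∑ i, ∑ a, (w i : ℂ) * (proj (x i) a a * proj (x i) c e) := by
          refine Finset.sum_congr rfl fun i _ => ?_
          rw [← Finset.mul_sum, ← Finset.sum_mul, trace_proj _ (hx i), one_mul]
      _ = ∑ a : Fin d, ((d : ℂ) * (d + 1))⁻¹ *
            ((if c = e then 1 else 0) + if a = e ∧ c = a then 1 else 0) := by
          rw [Finset.sum_comm]
          simp [entry]
      _ = _ := by
          have h : ∑ a : Fin d, (if a = e ∧ c = a then (1 : ℂ) else 0)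
              = if c = e then 1 else 0 := by
            simp [ite_and, eq_comm]
          rw [← Finset.mul_sum, Finset.sum_add_distrib, h]
          simp only [Finset.sum_const, Finset.card_univ, Fintype.card_fin, nsmul_eq_mul]
          field_simp
  have weighted : ∀ c e, ∑ i, (w i : ℂ) * (Matrix.trace (proj (x i) * A) * proj (x i) c e)
      = ((d : ℂ) * (d + 1))⁻¹ * (Matrix.trace A * (if c = e then 1 else 0) + A c e) := by
    intro c e
    calc ∑ i, (w i : ℂ) * (Matrix.trace (proj (x i) * A) * proj (x i) c e)
        = ∑ i, ∑ a, ∑ b, A b a * ((w i : ℂ) * (proj (x i) a b * proj (x i) c e)) := by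
          refine Finset.sum_congr rfl fun i _ => ?_
          simp only [Matrix.trace, Matrix.diag_apply, Matrix.mul_apply, Finset.sum_mul,
            Finset.mul_sum]
          refine Finset.sum_congr rfl fun a _ => Finset.sum_congr rfl fun b _ => ?_
          ring
      _ = ∑ a, ∑ b, A b a * (((d : ℂ) * (d + 1))⁻¹ *
            ((if a = b then 1 else 0) * (if c = e then 1 else 0)
              + if a = e ∧ c = b then 1 else 0)) := by
          rw [Finset.sum_comm]
          refine Finset.sum_congr rfl fun a _ => ?_
          rw [Finset.sum_comm]
          refine Finset.sum_congr rfl fun b _ => ?_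
          rw [← Finset.mul_sum, entry]
      _ = ((d : ℂ) * (d + 1))⁻¹ *
            ((∑ a, ∑ b, A b a * (if a = b then 1 else 0)) * (if c = e then 1 else 0)
              + ∑ a, ∑ b, A b a * if a = e ∧ c = b then 1 else 0) := by
          simp only [Finset.sum_mul, ← Finset.sum_add_distrib, Finset.mul_sum]
          refine Finset.sum_congr rfl fun a _ => Finset.sum_congr rfl fun b _ => ?_
          ring
      _ = _ := by
          simp [ite_and, Matrix.trace]
  ext c e
  simp only [Matrix.smul_apply, Matrix.sum_apply, smul_eq_mul]
  have split : ∑ i, (w i : ℂ) *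
        ((((d : ℂ) + 1) * Matrix.trace (proj (x i) * A) - Matrix.trace A) * proj (x i) c e)
      = ((d : ℂ) + 1) * ∑ i, (w i : ℂ) * (Matrix.trace (proj (x i) * A) * proj (x i) c e)
        - Matrix.trace A * ∑ i, (w i : ℂ) * proj (x i) c e := by
    simp only [Finset.mul_sum, ← Finset.sum_sub_distrib]
    refine Finset.sum_congr rfl fun i _ => ?_
    ring
  rw [split, weighted, marginal]
  field_simp
  ring
end

section
/- (Proposition 8, finite case) Let F : ι → Matrix (Fin d) (Fin d) ℂ be a finite POVM on ℂ^d with τ(x) := tr F(x) > 0 and P(x) := τ(x)⁻¹ • F(x). Then the following are equivalent: (1) F is a tight IC-POVM and every P(x) is a rank-one projection (i.e. P(x) = π(v_x) for some unit vector v_x); (2) the POVM superoperator satisfies 𝓕(A) = (d+1)⁻¹ • (A + (tr A) • I) for every d×d complex matrix A. -/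
open Matrix
open scoped ComplexOrder

/-- `F` (with trace measure `τ` and POVD `P`) is a tight IC-POVM: the traceless parts of the
`P x` form a tight operator frame on the space of traceless operators. -/
def TightIC {d : ℕ} {ι : Type*} [Fintype ι]
    (τ : ι → ℝ) (P : ι → Matrix (Fin d) (Fin d) ℂ) : Prop :=
  ∃ a : ℝ, 0 < a ∧ ∀ A : Matrix (Fin d) (Fin d) ℂ,
    ∑ x, (τ x : ℂ) •
        (Matrix.trace ((P x - (d : ℂ)⁻¹ • 1)ᴴ * A) • (P x - (d : ℂ)⁻¹ • 1))
      = (a : ℂ) • (A - ((d : ℂ)⁻¹ * Matrix.trace A) • 1)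

section Helpers

variable {n ι : Type*} [Fintype n] [DecidableEq n] [Fintype ι]

lemma Matrix.IsHermitian.trace_mul_self_eq_sum_eigenvalues_sq {A : Matrix n n ℂ}
    (hA : A.IsHermitian) : (A * A).trace = ((∑ i, hA.eigenvalues i ^ 2 : ℝ) : ℂ) := by
  have h := hA.spectral_theorem
  have hsq : A * A = Unitary.conjStarAlgAut ℂ _ hA.eigenvectorUnitary
      (diagonal (RCLike.ofReal ∘ hA.eigenvalues) * diagonal (RCLike.ofReal ∘ hA.eigenvalues)) := by
    rw [map_mul, ← h]
  rw [hsq, Unitary.conjStarAlgAut_apply, Matrix.trace_mul_comm, ← mul_assoc,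
    Unitary.coe_star_mul_self, one_mul, diagonal_mul_diagonal, trace_diagonal]
  simp [pow_two]

lemma Matrix.IsHermitian.sum_eigenvalues_eq_one {A : Matrix n n ℂ}
    (hA : A.IsHermitian) (htr : A.trace = 1) : ∑ i, hA.eigenvalues i = 1 := by
  have h := hA.trace_eq_sum_eigenvalues
  rw [htr, ← RCLike.ofReal_sum] at h
  exact Complex.ofReal_eq_one.1 h.symm

lemma Matrix.PosSemidef.eigenvalues_le_one {A : Matrix n n ℂ}
    (hA : A.PosSemidef) (htr : A.trace = 1) (i : n) : hA.1.eigenvalues i ≤ 1 := by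
  rw [← hA.1.sum_eigenvalues_eq_one htr]
  exact Finset.single_le_sum (fun j _ => hA.eigenvalues_nonneg j) (Finset.mem_univ i)

lemma Matrix.PosSemidef.re_trace_mul_self_le_one {A : Matrix n n ℂ}
    (hA : A.PosSemidef) (htr : A.trace = 1) : (A * A).trace.re ≤ 1 := by
  rw [hA.1.trace_mul_self_eq_sum_eigenvalues_sq, Complex.ofReal_re,
    ← hA.1.sum_eigenvalues_eq_one htr]
  refine Finset.sum_le_sum fun i _ => ?_
  nlinarith [hA.eigenvalues_nonneg i, hA.eigenvalues_le_one htr i]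

/-- A density matrix of purity one is a pure state. -/
lemma Matrix.PosSemidef.exists_eq_proj {d : ℕ} {A : Matrix (Fin d) (Fin d) ℂ}
    (hA : A.PosSemidef) (htr : A.trace = 1) (hsq : (A * A).trace.re = 1) :
    ∃ v : EuclideanSpace ℂ (Fin d), ‖v‖ = 1 ∧ A = proj v := by
  have h1 := hA.1.sum_eigenvalues_eq_one htr
  rw [hA.1.trace_mul_self_eq_sum_eigenvalues_sq, Complex.ofReal_re] at hsq
  have h0 : ∑ i, hA.1.eigenvalues i * (1 - hA.1.eigenvalues i) = 0 := by
    simp only [mul_sub, mul_one, ← pow_two, Finset.sum_sub_distrib]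
    linarith
  rw [Finset.sum_eq_zero_iff_of_nonneg fun i _ => mul_nonneg (hA.eigenvalues_nonneg i)
    (sub_nonneg.2 (hA.eigenvalues_le_one htr i))] at h0
  obtain ⟨k, -, hk⟩ := Finset.exists_ne_zero_of_sum_ne_zero (h1.trans_ne one_ne_zero)
  have hk1 : hA.1.eigenvalues k = 1 := by
    have := (mul_eq_zero.1 (h0 k (Finset.mem_univ k))).resolve_left hk
    linarith
  have hne : ∀ j, j ≠ k → hA.1.eigenvalues j = 0 := by
    rw [← Finset.add_sum_erase _ _ (Finset.mem_univ k), hk1, add_eq_left,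
      Finset.sum_eq_zero_iff_of_nonneg fun i _ => hA.eigenvalues_nonneg i] at h1
    exact fun j hj => h1 j (by simp [hj])
  refine ⟨hA.1.eigenvectorBasis k, hA.1.eigenvectorBasis.orthonormal.1 k, ?_⟩
  ext i j
  conv_lhs => rw [hA.1.spectral_theorem, Unitary.conjStarAlgAut_apply]
  rw [Matrix.mul_apply, Finset.sum_eq_single k]
  · simp [Matrix.mul_diagonal, hk1, proj, Matrix.star_apply]
  · intro l _ hl
    simp [Matrix.mul_diagonal, hne l hl]
  · simp

lemma trace_proj_mul_self {d : ℕ} {v : EuclideanSpace ℂ (Fin d)} (hv : ‖v‖ = 1) :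
    (proj v * proj v).trace = 1 := by
  have h : ∑ i, (starRingEnd ℂ) (v i) * v i = 1 := by
    have := EuclideanSpace.norm_sq_eq v
    rw [hv] at this
    simp only [Complex.conj_mul']
    exact_mod_cast this.symm.trans (one_pow 2)
  calc (proj v * proj v).trace
      = ∑ i, ∑ j, ((starRingEnd ℂ) (v i) * v i) * ((starRingEnd ℂ) (v j) * v j) := by
        simp only [Matrix.trace, Matrix.diag, Matrix.mul_apply, proj, Matrix.of_apply]
        refine Finset.sum_congr rfl fun i _ => Finset.sum_congr rfl fun j _ => ?_
        ring
    _ = 1 := by rw [← Finset.sum_mul_sum, h, one_mul]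

lemma sum_smul_traceless_part {τ : ι → ℝ} {P : ι → Matrix n n ℂ}
    (hherm : ∀ x, (P x).IsHermitian) (hsum : ∑ x, (τ x : ℂ) • P x = 1)
    (hτ : ∑ x, (τ x : ℂ) = Fintype.card n) (hn : (Fintype.card n : ℂ) ≠ 0) (A : Matrix n n ℂ) :
    ∑ x, (τ x : ℂ) • (trace ((P x - (Fintype.card n : ℂ)⁻¹ • 1)ᴴ * A) •
        (P x - (Fintype.card n : ℂ)⁻¹ • 1))
      = ∑ x, (τ x : ℂ) • (trace ((P x)ᴴ * A) • P x)
        - ((Fintype.card n : ℂ)⁻¹ * trace A) • (1 : Matrix n n ℂ) := by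
  set c : ℂ := (Fintype.card n : ℂ)⁻¹ with hc
  have hstar : star c = c := by simp [hc]
  have htr : ∑ x, (τ x : ℂ) * trace ((P x)ᴴ * A) = trace A := by
    conv_rhs => rw [← one_mul A, ← hsum, Finset.sum_mul, trace_sum]
    refine Finset.sum_congr rfl fun x _ => ?_
    rw [(hherm x).eq, smul_mul_assoc, trace_smul, smul_eq_mul]
  have hterm : ∀ x, (τ x : ℂ) • (trace ((P x - c • 1)ᴴ * A) • (P x - c • 1))
      = (τ x : ℂ) • (trace ((P x)ᴴ * A) • P x)
        - (c * ((τ x : ℂ) * trace ((P x)ᴴ * A))) • (1 : Matrix n n ℂ)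
        - (c * trace A) • ((τ x : ℂ) • P x)
        + (c * c * trace A * (τ x : ℂ)) • (1 : Matrix n n ℂ) := by
    intro x
    rw [conjTranspose_sub, conjTranspose_smul, conjTranspose_one, hstar, sub_mul, trace_sub,
      smul_mul_assoc, one_mul, trace_smul, smul_eq_mul]
    module
  simp only [hterm, Finset.sum_add_distrib, Finset.sum_sub_distrib, ← Finset.sum_smul,
    ← Finset.smul_sum, ← Finset.mul_sum, htr, hsum, hτ]
  have : c * c * trace A * (Fintype.card n : ℂ) = c * trace A := by
    rw [hc]; field_simp
  rw [this]
  abel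

/-- Computing the trace of the superoperator `A ↦ ∑ τ ⟨P, A⟩ P` in two ways. -/
lemma sum_smul_trace_conjTranspose_mul_self {τ : ι → ℝ} {P : ι → Matrix n n ℂ} {a b : ℂ}
    (h : ∀ A : Matrix n n ℂ, ∑ x, (τ x : ℂ) • (trace ((P x)ᴴ * A) • P x)
      = a • A + (b * trace A) • 1) :
    ∑ x, (τ x : ℂ) * trace ((P x)ᴴ * P x)
      = a * (Fintype.card n : ℂ) ^ 2 + b * Fintype.card n := by
  have hij : ∀ i j, ∑ x, (τ x : ℂ) * (star (P x i j) * P x i j)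
      = a + if i = j then b else 0 := by
    intro i j
    have := congrFun (congrFun (h (single i j 1)) i) j
    simp only [Matrix.sum_apply, Matrix.smul_apply, Matrix.add_apply, smul_eq_mul,
      trace_mul_single, conjTranspose_apply, single_apply_same, mul_one] at this
    rcases eq_or_ne i j with rfl | hne
    · simpa using this
    · simpa [hne] using this
  have hcomm : ∑ x, (τ x : ℂ) * trace ((P x)ᴴ * P x)
      = ∑ j, ∑ i, ∑ x, (τ x : ℂ) * (star (P x i j) * P x i j) := by
    simp only [trace, diag, Matrix.mul_apply, conjTranspose_apply, Finset.mul_sum]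
    rw [Finset.sum_comm]
    exact Finset.sum_congr rfl fun _ _ => Finset.sum_comm
  rw [hcomm]
  simp only [hij, Finset.sum_add_distrib, Finset.sum_ite_eq', Finset.mem_univ, if_true,
    Finset.sum_const, Finset.card_univ, nsmul_eq_mul]
  ring

end Helpers

theorem stmt9 {d : ℕ} (hd : 1 ≤ d) {ι : Type*} [Fintype ι]
    (F : ι → Matrix (Fin d) (Fin d) ℂ)
    (hpos : ∀ x, (F x).PosSemidef) (hsum : ∑ x, F x = 1)
    (τ : ι → ℝ) (hτ : ∀ x, (τ x : ℂ) = Matrix.trace (F x)) (hτpos : ∀ x, 0 < τ x)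
    (P : ι → Matrix (Fin d) (Fin d) ℂ) (hP : ∀ x, P x = (τ x)⁻¹ • F x) :
    (TightIC τ P ∧ ∀ x, ∃ v : EuclideanSpace ℂ (Fin d), ‖v‖ = 1 ∧ P x = proj v)
    ↔ ∀ A : Matrix (Fin d) (Fin d) ℂ,
        ∑ x, (τ x : ℂ) • (Matrix.trace ((P x)ᴴ * A) • P x)
          = ((d : ℂ) + 1)⁻¹ • (A + Matrix.trace A • 1) := by
  have hd0 : (d : ℂ) ≠ 0 := by exact_mod_cast (by omega : d ≠ 0)
  have hd1 : (d : ℂ) + 1 ≠ 0 := by exact_mod_cast d.succ_ne_zero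
  have hτ0 : ∀ x, (τ x : ℂ) ≠ 0 := fun x => by exact_mod_cast (hτpos x).ne'
  have hFP : ∀ x, (τ x : ℂ) • P x = F x := fun x => by
    rw [hP, Complex.coe_smul, smul_inv_smul₀ (hτpos x).ne']
  have hPpos : ∀ x, (P x).PosSemidef := fun x => by
    rw [hP]; exact (hpos x).smul (inv_nonneg.2 (hτpos x).le)
  have htrP : ∀ x, (P x).trace = 1 := fun x => by
    apply mul_left_cancel₀ (hτ0 x)
    rw [← smul_eq_mul, ← trace_smul, hFP, mul_one, hτ]
  have hPsum : ∑ x, (τ x : ℂ) • P x = 1 := by simp only [hFP, hsum]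
  have hτsum : ∑ x, (τ x : ℂ) = d := by
    simp only [hτ, ← trace_sum, hsum, trace_one, Fintype.card_fin]
  have key := sum_smul_traceless_part (fun x => (hPpos x).1) hPsum
    (by rw [hτsum, Fintype.card_fin]) (by rwa [Fintype.card_fin])
  rw [Fintype.card_fin] at key
  constructor
  · rintro ⟨⟨a, -, ha⟩, hv⟩
    have hS : ∀ A : Matrix (Fin d) (Fin d) ℂ, ∑ x, (τ x : ℂ) • (trace ((P x)ᴴ * A) • P x)
        = (a : ℂ) • A + ((1 - a) * (d : ℂ)⁻¹ * trace A) • 1 := fun A => by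
      rw [sub_eq_iff_eq_add.1 ((key A).symm.trans (ha A))]
      module
    have hpure : ∀ x, trace ((P x)ᴴ * P x) = 1 := fun x => by
      obtain ⟨v, hv1, hPv⟩ := hv x
      rw [(hPpos x).1.eq, hPv, trace_proj_mul_self hv1]
    have htr := sum_smul_trace_conjTranspose_mul_self hS
    simp only [hpure, mul_one, hτsum, Fintype.card_fin] at htr
    have hfac : ((d : ℂ) - 1) * (a * (d + 1) - 1) = 0 := by
      field_simp at htr
      linear_combination -htr
    intro A
    rw [hS]
    rcases mul_eq_zero.1 hfac with h | h
    · obtain rfl : d = 1 := by exact_mod_cast sub_eq_zero.1 h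
      ext i j
      obtain rfl := Subsingleton.elim i 0
      obtain rfl := Subsingleton.elim j 0
      simp [trace]
      ring
    · have ha' : (a : ℂ) = ((d : ℂ) + 1)⁻¹ := eq_inv_of_mul_eq_one_left (sub_eq_zero.1 h)
      have hb : (1 - (a : ℂ)) * (d : ℂ)⁻¹ = ((d : ℂ) + 1)⁻¹ := by
        rw [ha']; field_simp; ring
      rw [hb, ha', smul_add, smul_smul]
  · intro h
    refine ⟨⟨((d : ℝ) + 1)⁻¹, by positivity, fun A => ?_⟩, ?_⟩
    · have hb : (d : ℂ)⁻¹ - ((d : ℂ) + 1)⁻¹ = ((d : ℂ) + 1)⁻¹ * (d : ℂ)⁻¹ := by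
        field_simp; ring
      rw [key, h]
      push_cast
      rw [smul_add, smul_sub, smul_smul, smul_smul, ← mul_assoc, ← hb]
      module
    · have htr := sum_smul_trace_conjTranspose_mul_self (a := ((d : ℂ) + 1)⁻¹)
        (b := ((d : ℂ) + 1)⁻¹) fun A => by rw [h, smul_add, smul_smul]
      rw [Fintype.card_fin] at htr
      have hre : ∑ x, τ x * (1 - (P x * P x).trace.re) = 0 := by
        have hC : ∑ x, (τ x : ℂ) * (1 - (P x * P x).trace) = 0 := by
          simp only [fun x => (hPpos x).1.eq] at htr
          simp only [mul_sub, mul_one, Finset.sum_sub_distrib, htr, hτsum]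
          field_simp
          ring
        simpa using congrArg Complex.re hC
      rw [Finset.sum_eq_zero_iff_of_nonneg fun x _ => mul_nonneg (hτpos x).le
        (sub_nonneg.2 ((hPpos x).re_trace_mul_self_le_one (htrP x)))] at hre
      intro x
      have hx := (mul_eq_zero.1 (hre x (Finset.mem_univ x))).resolve_left (hτpos x).ne'
      exact (hPpos x).exists_eq_proj (htrP x) (by linarith)
end

section
/- (Lemma 12, finite weighted case) Let A : ι → Matrix (Fin d) (Fin d) ℂ be a finite family of matrices with positive weights α : ι → ℝ whose frame superoperator 𝒜(C) = ∑_i α i · tr(A(i)ᴴ C) • A(i) is bijective, and let Ã(i) := 𝒜⁻¹(A(i)) be the canonical dual frame. Then for every family B : ι → Matrix (Fin d) (Fin d) ℂ satisfying ∑_i α i · tr(A(i)ᴴ C) • B(i) = C for all d×d matrices C (i.e., B is a dual frame of A), one has ∑_i α i · tr(B(i)ᴴ B(i)) ≥ ∑_i α i · tr(Ã(i)ᴴ Ã(i)), with equality only if B(i) = Ã(i) for all i. -/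
open Matrix

section FrameSuperoperator

variable {n ι : Type*} [Fintype n] [Fintype ι]

/-- The frame superoperator is self-adjoint for the Frobenius inner product. -/
theorem trace_conjTranspose_mul_frame (A : ι → Matrix n n ℂ) (α : ι → ℝ) (X Y : Matrix n n ℂ) :
    trace (Xᴴ * ∑ j, (α j : ℂ) • (trace ((A j)ᴴ * Y) • A j)) =
      trace ((∑ j, (α j : ℂ) • (trace ((A j)ᴴ * X) • A j))ᴴ * Y) := by
  simp only [Matrix.mul_sum, Matrix.trace_sum, Matrix.conjTranspose_sum, Matrix.sum_mul,
    Matrix.conjTranspose_smul, Matrix.mul_smul, Matrix.smul_mul, Matrix.trace_smul, smul_eq_mul]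
  refine Finset.sum_congr rfl fun j _ => ?_
  rw [← Matrix.trace_conjTranspose ((A j)ᴴ * X), Matrix.conjTranspose_mul,
    Matrix.conjTranspose_conjTranspose]
  simp only [RCLike.star_def, Complex.conj_ofReal]
  ring

/-- The weighted diagonal Frobenius pairing vanishes when the associated mixed
superoperator does. -/
theorem sum_trace_conjTranspose_mul_eq_zero (X D : ι → Matrix n n ℂ) (α : ι → ℝ)
    (h : ∀ C : Matrix n n ℂ, ∑ i, (α i : ℂ) • (trace ((X i)ᴴ * C) • D i) = 0) :
    ∑ i, (α i : ℂ) * trace ((X i)ᴴ * D i) = 0 := by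
  classical
  have hentry (k l : n) : ∑ i, (α i : ℂ) * (star (X i k l) * D i k l) = 0 := by
    simpa [Matrix.sum_apply, Matrix.trace_mul_single] using
      congrFun (congrFun (h (Matrix.single k l 1)) k) l
  simp only [Matrix.trace, Matrix.diag_apply, Matrix.mul_apply, Matrix.conjTranspose_apply,
    Finset.mul_sum]
  rw [Finset.sum_comm]
  refine Finset.sum_eq_zero fun l _ => ?_
  rw [Finset.sum_comm]
  exact Finset.sum_eq_zero fun k _ => hentry k l

theorem re_trace_conjTranspose_mul_self_add (X D : Matrix n n ℂ) :
    (trace ((X + D)ᴴ * (X + D))).re =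
      (trace (Xᴴ * X)).re + (trace (Dᴴ * D)).re + 2 * (trace (Xᴴ * D)).re := by
  have h : (trace (Dᴴ * X)).re = (trace (Xᴴ * D)).re := by
    rw [← Complex.conj_re (trace (Xᴴ * D)), ← RCLike.star_def, ← Matrix.trace_conjTranspose,
      Matrix.conjTranspose_mul, Matrix.conjTranspose_conjTranspose]
  simp only [Matrix.conjTranspose_add, Matrix.add_mul, Matrix.mul_add, Matrix.trace_add,
    Complex.add_re, h]
  ring

open scoped ComplexOrder in
theorem re_trace_conjTranspose_mul_self_nonneg (D : Matrix n n ℂ) :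
    0 ≤ (trace (Dᴴ * D)).re :=
  (Complex.le_def.1 (Matrix.posSemidef_conjTranspose_mul_self D).trace_nonneg).1

open scoped ComplexOrder in
theorem eq_zero_of_re_trace_conjTranspose_mul_self_eq_zero {D : Matrix n n ℂ}
    (h : (trace (Dᴴ * D)).re = 0) : D = 0 := by
  have hnonneg := Complex.le_def.1 (Matrix.posSemidef_conjTranspose_mul_self D).trace_nonneg
  exact Matrix.trace_conjTranspose_mul_self_eq_zero_iff.1 (Complex.ext h hnonneg.2.symm)

end FrameSuperoperator

theorem stmt13 {d : ℕ} (hd : 1 ≤ d) {ι : Type*} [Fintype ι]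
    (A : ι → Matrix (Fin d) (Fin d) ℂ) (α : ι → ℝ) (hα : ∀ i, 0 < α i)
    (hbij : Function.Bijective (fun C : Matrix (Fin d) (Fin d) ℂ =>
      ∑ i, (α i : ℂ) • (Matrix.trace ((A i)ᴴ * C) • A i)))
    (Atilde : ι → Matrix (Fin d) (Fin d) ℂ)
    (hAtilde : ∀ i, ∑ j, (α j : ℂ) • (Matrix.trace ((A j)ᴴ * Atilde i) • A j) = A i)
    (B : ι → Matrix (Fin d) (Fin d) ℂ)
    (hB : ∀ C : Matrix (Fin d) (Fin d) ℂ,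
      ∑ i, (α i : ℂ) • (Matrix.trace ((A i)ᴴ * C) • B i) = C) :
    ∑ i, α i * (Matrix.trace ((Atilde i)ᴴ * Atilde i)).re ≤
      ∑ i, α i * (Matrix.trace ((B i)ᴴ * B i)).re ∧
    ((∑ i, α i * (Matrix.trace ((B i)ᴴ * B i)).re
        = ∑ i, α i * (Matrix.trace ((Atilde i)ᴴ * Atilde i)).re) →
      ∀ i, B i = Atilde i) := by
  have hself (i : ι) (F : Matrix (Fin d) (Fin d) ℂ) :
      trace ((Atilde i)ᴴ * ∑ j, (α j : ℂ) • (trace ((A j)ᴴ * F) • A j)) =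
        trace ((A i)ᴴ * F) := by
    rw [trace_conjTranspose_mul_frame, hAtilde]
  have hdual (C : Matrix (Fin d) (Fin d) ℂ) :
      ∑ i, (α i : ℂ) • (trace ((A i)ᴴ * C) • Atilde i) = C := by
    apply hbij.1
    have hlin : ∑ j, (α j : ℂ) • (trace ((A j)ᴴ *
          ∑ i, (α i : ℂ) • (trace ((A i)ᴴ * C) • Atilde i)) • A j) =
        ∑ i, (α i : ℂ) • (trace ((A i)ᴴ * C) •
          ∑ j, (α j : ℂ) • (trace ((A j)ᴴ * Atilde i) • A j)) := by
      simp only [Matrix.mul_sum, Matrix.trace_sum, Matrix.mul_smul, Matrix.trace_smul,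
        Finset.sum_smul, Finset.smul_sum, smul_smul, smul_eq_mul]
      rw [Finset.sum_comm]
      refine Finset.sum_congr rfl fun i _ => Finset.sum_congr rfl fun j _ => ?_
      congr 1
      ring
    simpa only [hAtilde] using hlin
  have hmixed (C : Matrix (Fin d) (Fin d) ℂ) :
      ∑ i, (α i : ℂ) • (trace ((Atilde i)ᴴ * C) • (B i - Atilde i)) = 0 := by
    obtain ⟨F, rfl⟩ := hbij.2 C
    simp only [hself, smul_sub, Finset.sum_sub_distrib, hB, hdual, sub_self]
  have horth : ∑ i, α i * (trace ((Atilde i)ᴴ * (B i - Atilde i))).re = 0 := by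
    simpa using congrArg Complex.re (sum_trace_conjTranspose_mul_eq_zero _ _ α hmixed)
  have hpyth : ∑ i, α i * (trace ((B i)ᴴ * B i)).re =
      ∑ i, α i * (trace ((Atilde i)ᴴ * Atilde i)).re +
        ∑ i, α i * (trace ((B i - Atilde i)ᴴ * (B i - Atilde i))).re := by
    rw [← add_zero (_ + _), ← mul_zero 2, ← horth, Finset.mul_sum, ← Finset.sum_add_distrib,
      ← Finset.sum_add_distrib]
    refine Finset.sum_congr rfl fun i _ => ?_
    have h := re_trace_conjTranspose_mul_self_add (Atilde i) (B i - Atilde i)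
    rw [add_sub_cancel] at h
    rw [h]
    ring
  have hnonneg (i : ι) : 0 ≤ α i * (trace ((B i - Atilde i)ᴴ * (B i - Atilde i))).re :=
    mul_nonneg (hα i).le (re_trace_conjTranspose_mul_self_nonneg _)
  rw [hpyth]
  refine ⟨le_add_of_nonneg_right (Finset.sum_nonneg fun i _ => hnonneg i), fun heq i => ?_⟩
  have hzero := (Finset.sum_eq_zero_iff_of_nonneg fun i _ => hnonneg i).1
    (add_eq_left.1 heq) i (Finset.mem_univ i)
  exact sub_eq_zero.1 (eq_zero_of_re_trace_conjTranspose_mul_self_eq_zero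
    ((mul_eq_zero.1 hzero).resolve_left (hα i).ne'))
end

section
/- (Lemma 13, finite case) Let F be a finite informationally complete POVM on ℂ^d with τ(x) := tr F(x) > 0 and P(x) := τ(x)⁻¹ • F(x). Then the POVM superoperator 𝓕, viewed as a ℂ-linear endomorphism of the d²-dimensional space of d×d matrices, is bijective, and the trace of its inverse satisfies Tr(𝓕⁻¹) ≥ d(d(d+1) − 1), with equality if and only if 𝓕(A) = (d+1)⁻¹ • (A + (tr A) • I) for every A (i.e., F is a tight rank-one IC-POVM). -/
open Matrix
open scoped ComplexOrder

section Helpers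

variable {n ι : Type*} [Fintype n]

/-- For a positive semidefinite matrix, `tr (Aᴴ A) ≤ (tr A)²`. -/
theorem Matrix.PosSemidef.trace_conjTranspose_mul_self_re_le {A : Matrix n n ℂ}
    (hA : A.PosSemidef) : (trace (Aᴴ * A)).re ≤ (trace A).re ^ 2 := by
  classical
  have hsq : ∀ M : Matrix n n ℂ, (trace (Mᴴ * M)).re = ∑ i, ∑ j, ‖M i j‖ ^ 2 := by
    intro M
    simp only [trace, diag_apply, mul_apply, conjTranspose_apply, Complex.re_sum]
    rw [Finset.sum_comm]
    refine Finset.sum_congr rfl fun i _ => Finset.sum_congr rfl fun j _ => ?_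
    rw [← Complex.normSq_eq_norm_sq, Complex.normSq_apply]
    simp
  let := Matrix.frobeniusNormedAddCommGroup (m := n) (n := n) (α := ℂ)
  have hnorm : ∀ M : Matrix n n ℂ, (trace (Mᴴ * M)).re = ‖M‖ ^ 2 := by
    intro M
    rw [hsq, frobenius_norm_def, ← Real.sqrt_eq_rpow, Real.sq_sqrt (by positivity)]
    simp
  obtain ⟨B, rfl⟩ : ∃ B : Matrix n n ℂ, A = Bᴴ * B := by
    open scoped MatrixOrder in
    exact CStarAlgebra.nonneg_iff_eq_star_mul_self.mp hA.nonneg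
  rw [hnorm, hnorm]
  gcongr
  calc ‖Bᴴ * B‖ ≤ ‖Bᴴ‖ * ‖B‖ := frobenius_norm_mul _ _
    _ = ‖B‖ ^ 2 := by rw [frobenius_norm_conjTranspose, sq]

theorem Matrix.trace_conjTranspose_mul_comm_star (A B : Matrix n n ℂ) :
    trace (Aᴴ * B) = star (trace (Bᴴ * A)) := by
  rw [← trace_conjTranspose, conjTranspose_mul, conjTranspose_conjTranspose]

/-- A traceless Hermitian matrix annihilated by the measurement statistics of an informationally
complete family vanishes. -/
theorem eq_zero_of_isHermitian_of_informationallyComplete [Nonempty n] {F : ι → Matrix n n ℂ}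
    (hIC : ∀ ρ σ : Matrix n n ℂ,
      ρ.PosSemidef → σ.PosSemidef → trace ρ = 1 → trace σ = 1 →
      (∀ x, trace (F x * ρ) = trace (F x * σ)) → ρ = σ)
    {H : Matrix n n ℂ} (hH : H.IsHermitian) (htr : trace H = 0)
    (hF : ∀ x, trace (F x * H) = 0) : H = 0 := by
  classical
  have hps : ((1 + H)ᴴ * (1 + H)).PosSemidef := posSemidef_conjTranspose_mul_self _
  have hms : ((1 - H)ᴴ * (1 - H)).PosSemidef := posSemidef_conjTranspose_mul_self _
  have hHH : 0 ≤ trace (H * H) := by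
    have := (posSemidef_conjTranspose_mul_self H).trace_nonneg
    rwa [hH.eq] at this
  have hp : (1 + H)ᴴ * (1 + H) = 1 + H * H + (2 : ℂ) • H := by
    rw [conjTranspose_add, conjTranspose_one, hH.eq, two_smul]; noncomm_ring
  have hm : (1 - H)ᴴ * (1 - H) = 1 + H * H - (2 : ℂ) • H := by
    rw [conjTranspose_sub, conjTranspose_one, hH.eq, two_smul]; noncomm_ring
  rw [hp] at hps
  rw [hm] at hms
  set t : ℂ := Fintype.card n + trace (H * H) with ht
  have htpos : 0 < t := add_pos_of_pos_of_nonneg (by exact_mod_cast Fintype.card_pos) hHH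
  have hinv : 0 ≤ t⁻¹ := (inv_pos.mpr htpos).le
  have heq := hIC _ _ (hps.smul hinv) (hms.smul hinv)
    (by simp [trace_add, htr, ← ht, ← mul_add, htpos.ne'])
    (by simp [trace_add, trace_sub, htr, ← ht, htpos.ne'])
    (fun x => by simp [mul_add, mul_sub, trace_add, trace_sub, hF])
  have h2 := smul_right_injective _ (inv_ne_zero htpos.ne') heq
  have h4 : (4 : ℂ) • H = 0 := by
    have : (4 : ℂ) • H = (1 + H * H + (2 : ℂ) • H) - (1 + H * H - (2 : ℂ) • H) := by module
    rw [this]; exact sub_eq_zero.mpr h2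
  exact (smul_eq_zero.mp h4).resolve_left (by norm_num)

/-- The statistics of an informationally complete POVM determine every matrix. -/
theorem eq_zero_of_informationallyComplete [Fintype ι] [Nonempty n] [DecidableEq n]
    {F : ι → Matrix n n ℂ}
    (hherm : ∀ x, (F x).IsHermitian) (hsum : ∑ x, F x = 1)
    (hIC : ∀ ρ σ : Matrix n n ℂ,
      ρ.PosSemidef → σ.PosSemidef → trace ρ = 1 → trace σ = 1 →
      (∀ x, trace (F x * ρ) = trace (F x * σ)) → ρ = σ)
    {A : Matrix n n ℂ} (hF : ∀ x, trace (F x * A) = 0) : A = 0 := by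
  have htr : ∀ B : Matrix n n ℂ, (∀ x, trace (F x * B) = 0) → trace B = 0 := by
    intro B hB
    rw [← one_mul B, ← hsum, Finset.sum_mul, trace_sum]
    exact Finset.sum_eq_zero fun x _ => hB x
  have hstar : ∀ x, trace (F x * Aᴴ) = 0 := by
    intro x
    rw [trace_mul_comm, ← (hherm x).eq, ← conjTranspose_mul, trace_conjTranspose, hF, star_zero]
  have hre : ∀ x, trace (F x * (A + Aᴴ)) = 0 := by
    intro x; rw [mul_add, trace_add, hF, hstar, add_zero]
  have him : ∀ x, trace (F x * (Complex.I • (A - Aᴴ))) = 0 := by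
    intro x; rw [mul_smul_comm, mul_sub, trace_smul, trace_sub, hF, hstar, sub_zero, smul_zero]
  have h1 := eq_zero_of_isHermitian_of_informationallyComplete hIC
    (isHermitian_add_transpose_self A) (htr _ hre) hre
  have h2 := eq_zero_of_isHermitian_of_informationallyComplete hIC
    (by
      unfold IsHermitian
      rw [conjTranspose_smul, conjTranspose_sub, conjTranspose_conjTranspose, Complex.star_def,
        Complex.conj_I]
      module) (htr _ him) him
  have h3 := (smul_eq_zero.mp h2).resolve_left Complex.I_ne_zero
  have h4 : (2 : ℂ) • A = 0 := by
    have : (2 : ℂ) • A = (A + Aᴴ) + (A - Aᴴ) := by module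
    rw [this, h1, h3, add_zero]
  exact (smul_eq_zero.mp h4).resolve_left two_ne_zero

section Superoperator

variable [Fintype ι] {w : ι → ℝ} {P : ι → Matrix n n ℂ} {G : Matrix n n ℂ →ₗ[ℂ] Matrix n n ℂ}

theorem trace_mul_superoperator
    (hG : ∀ A, G A = ∑ x, (w x : ℂ) • (trace ((P x)ᴴ * A) • P x)) (A B : Matrix n n ℂ) :
    trace (Aᴴ * G B) = ∑ x, (w x : ℂ) * (trace ((P x)ᴴ * B) * trace (Aᴴ * P x)) := by
  simp [hG, Finset.mul_sum, trace_sum]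

/-- The superoperator is self-adjoint for the Frobenius inner product. -/
theorem superoperator_selfAdjoint
    (hG : ∀ A, G A = ∑ x, (w x : ℂ) • (trace ((P x)ᴴ * A) • P x)) (A B : Matrix n n ℂ) :
    trace ((G A)ᴴ * B) = trace (Aᴴ * G B) := by
  rw [trace_conjTranspose_mul_comm_star, trace_mul_superoperator hG, trace_mul_superoperator hG,
    star_sum]
  refine Finset.sum_congr rfl fun x _ => ?_
  rw [star_mul', star_mul', ← trace_conjTranspose_mul_comm_star,
    ← trace_conjTranspose_mul_comm_star, mul_comm (trace (Aᴴ * P x))]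
  simp

/-- A matrix in the kernel of the superoperator has vanishing statistics. -/
theorem trace_eq_zero_of_superoperator_eq_zero (hw : ∀ x, 0 < w x)
    (hG : ∀ A, G A = ∑ x, (w x : ℂ) • (trace ((P x)ᴴ * A) • P x)) {A : Matrix n n ℂ}
    (hA : G A = 0) (x : ι) : trace ((P x)ᴴ * A) = 0 := by
  have h := trace_mul_superoperator hG A A
  rw [hA, mul_zero, trace_zero] at h
  have hterm : ∀ y, (w y : ℂ) * (trace ((P y)ᴴ * A) * trace (Aᴴ * P y))
      = ((w y * Complex.normSq (trace ((P y)ᴴ * A)) : ℝ) : ℂ) := by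
    intro y
    rw [trace_conjTranspose_mul_comm_star A, Complex.star_def, Complex.mul_conj,
      Complex.ofReal_mul]
  simp_rw [hterm] at h
  rw [← Complex.ofReal_sum, eq_comm, Complex.ofReal_eq_zero,
    Finset.sum_eq_zero_iff_of_nonneg fun y _ =>
      mul_nonneg (hw y).le (Complex.normSq_nonneg _)] at h
  exact Complex.normSq_eq_zero.mp ((mul_eq_zero.mp (h x (Finset.mem_univ x))).resolve_left
    (hw x).ne')

theorem trace_comp_superoperator
    (hG : ∀ A, G A = ∑ x, (w x : ℂ) • (trace ((P x)ᴴ * A) • P x))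
    (L : Matrix n n ℂ →ₗ[ℂ] Matrix n n ℂ) :
    LinearMap.trace ℂ (Matrix n n ℂ) (L ∘ₗ G)
      = ∑ x, (w x : ℂ) * trace ((P x)ᴴ * L (P x)) := by
  have hLG : L ∘ₗ G = ∑ x, (w x : ℂ) •
      (traceLinearMap n ℂ ℂ ∘ₗ LinearMap.mulLeft ℂ (P x)ᴴ).smulRight (L (P x)) := by
    ext1 A
    simp [hG, LinearMap.sum_apply]
  rw [hLG, map_sum]
  refine Finset.sum_congr rfl fun x _ => ?_
  rw [map_smul, LinearMap.trace_smulRight]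
  simp

end Superoperator

/-- The map `A ↦ a A - b tr(A) 1`. -/
noncomputable def isotropicMap (n : Type*) [Fintype n] [DecidableEq n] (a b : ℂ) :
    Matrix n n ℂ →ₗ[ℂ] Matrix n n ℂ :=
  a • LinearMap.id - b • (traceLinearMap n ℂ ℂ).smulRight 1

section Isotropic

variable [DecidableEq n]

theorem isotropicMap_apply (a b : ℂ) (A : Matrix n n ℂ) :
    isotropicMap n a b A = a • A - b • (trace A • (1 : Matrix n n ℂ)) := by
  simp [isotropicMap]

theorem trace_isotropicMap (a b : ℂ) :
    LinearMap.trace ℂ (Matrix n n ℂ) (isotropicMap n a b)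
      = a * (Fintype.card n) ^ 2 - b * Fintype.card n := by
  rw [isotropicMap, map_sub, map_smul, map_smul, LinearMap.trace_id, LinearMap.trace_smulRight,
    Module.finrank_matrix]
  simp [sq]

theorem isotropicMap_selfAdjoint (a b : ℝ) (A B : Matrix n n ℂ) :
    trace ((isotropicMap n a b A)ᴴ * B) = trace (Aᴴ * isotropicMap n a b B) := by
  simp only [isotropicMap_apply, conjTranspose_sub, conjTranspose_smul, conjTranspose_one,
    sub_mul, mul_sub, smul_mul_assoc, mul_smul_comm, one_mul, mul_one, trace_sub, trace_smul,
    trace_conjTranspose, Complex.star_def, Complex.conj_ofReal, smul_eq_mul]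
  ring

end Isotropic

end Helpers

theorem stmt14 {d : ℕ} (hd : 1 ≤ d) {ι : Type*} [Fintype ι]
    (F : ι → Matrix (Fin d) (Fin d) ℂ)
    (hpos : ∀ x, (F x).PosSemidef) (hsum : ∑ x, F x = 1)
    (τ : ι → ℝ) (hτ : ∀ x, (τ x : ℂ) = Matrix.trace (F x)) (hτpos : ∀ x, 0 < τ x)
    (P : ι → Matrix (Fin d) (Fin d) ℂ) (hP : ∀ x, P x = (τ x)⁻¹ • F x)
    (hIC : ∀ ρ σ : Matrix (Fin d) (Fin d) ℂ,
      ρ.PosSemidef → σ.PosSemidef → Matrix.trace ρ = 1 → Matrix.trace σ = 1 →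
      (∀ x, Matrix.trace (F x * ρ) = Matrix.trace (F x * σ)) → ρ = σ)
    (G : Matrix (Fin d) (Fin d) ℂ →ₗ[ℂ] Matrix (Fin d) (Fin d) ℂ)
    (hG : ∀ A, G A = ∑ x, (τ x : ℂ) • (Matrix.trace ((P x)ᴴ * A) • P x)) :
    Function.Bijective G ∧
    ∀ Ginv : Matrix (Fin d) (Fin d) ℂ →ₗ[ℂ] Matrix (Fin d) (Fin d) ℂ,
      Ginv ∘ₗ G = LinearMap.id →
        (d : ℝ) * ((d : ℝ) * ((d : ℝ) + 1) - 1) ≤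
          (LinearMap.trace ℂ (Matrix (Fin d) (Fin d) ℂ) Ginv).re ∧
        (((LinearMap.trace ℂ (Matrix (Fin d) (Fin d) ℂ) Ginv).re
            = (d : ℝ) * ((d : ℝ) * ((d : ℝ) + 1) - 1))
          ↔ ∀ A : Matrix (Fin d) (Fin d) ℂ,
              G A = ((d : ℂ) + 1)⁻¹ • (A + Matrix.trace A • 1)) := by
  have : Nonempty (Fin d) := ⟨⟨0, hd⟩⟩
  have hτ0 : ∀ x, (τ x : ℂ) ≠ 0 := fun x => by exact_mod_cast (hτpos x).ne'
  have hP' : ∀ x, P x = (τ x : ℂ)⁻¹ • F x := fun x => by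
    rw [hP, ← Complex.ofReal_inv]; rfl
  have hFP : ∀ x, F x = (τ x : ℂ) • P x := fun x => by
    rw [hP', smul_inv_smul₀ (hτ0 x)]
  have hPpos : ∀ x, (P x).PosSemidef := fun x => by
    rw [hP']
    exact (hpos x).smul (by
      rw [← Complex.ofReal_inv]; exact_mod_cast (inv_pos.mpr (hτpos x)).le)
  have hPtr : ∀ x, trace (P x) = 1 := fun x => by
    rw [hP', trace_smul, ← hτ, smul_eq_mul, inv_mul_cancel₀ (hτ0 x)]
  have hτsum : ∑ x, (τ x : ℂ) = d := by
    simp_rw [hτ]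
    rw [← trace_sum, hsum, trace_one, Fintype.card_fin]
  have hinj : Function.Injective G := by
    refine (injective_iff_map_eq_zero G).mpr fun A hA => ?_
    refine eq_zero_of_informationallyComplete (fun x => (hpos x).isHermitian) hsum hIC fun x => ?_
    have := trace_eq_zero_of_superoperator_eq_zero hτpos hG hA x
    rw [(hPpos x).isHermitian.eq] at this
    rw [hFP, smul_mul_assoc, trace_smul, this, smul_zero]
  have hsurj : Function.Surjective G := LinearMap.injective_iff_surjective.mp hinj
  have hGtr : ∀ A, trace (G A) = trace A := by
    intro A
    have hG1 : G 1 = 1 := by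
      rw [hG, ← hsum]
      refine Finset.sum_congr rfl fun x _ => ?_
      rw [hsum, mul_one, trace_conjTranspose, hPtr, star_one, one_smul, ← hFP]
    have h := superoperator_selfAdjoint hG 1 A
    rw [hG1, conjTranspose_one, one_mul, one_mul] at h
    exact h.symm
  refine ⟨⟨hinj, hsurj⟩, fun Ginv hGinv => ?_⟩
  have hleft : ∀ A, Ginv (G A) = A := fun A => LinearMap.congr_fun hGinv A
  have hright : ∀ A, G (Ginv A) = A := fun A => by
    obtain ⟨B, rfl⟩ := hsurj A
    rw [hleft]
  set S := isotropicMap (Fin d) ((d + 1 : ℝ) : ℂ) ((1 : ℝ) : ℂ) with hS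
  set H := Ginv - S with hH
  have hHadj : ∀ A B, trace ((H A)ᴴ * B) = trace (Aᴴ * H B) := by
    intro A B
    have hGinvadj : trace ((Ginv A)ᴴ * B) = trace (Aᴴ * Ginv B) := by
      conv_lhs => rw [← hright B]
      rw [← superoperator_selfAdjoint hG, hright]
    simp only [hH, LinearMap.sub_apply, conjTranspose_sub, sub_mul, mul_sub, trace_sub, hGinvadj,
      hS, isotropicMap_selfAdjoint]
  have hquad : (LinearMap.trace ℂ (Matrix (Fin d) (Fin d) ℂ) ((H ∘ₗ H) ∘ₗ G)).re
      = ∑ x, τ x * (trace ((H (P x))ᴴ * H (P x))).re := by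
    rw [trace_comp_superoperator hG, Complex.re_sum]
    refine Finset.sum_congr rfl fun x _ => ?_
    rw [Complex.re_ofReal_mul, LinearMap.comp_apply, ← hHadj]
  have hterm : ∀ x, 0 ≤ τ x * (trace ((H (P x))ᴴ * H (P x))).re := fun x =>
    mul_nonneg (hτpos x).le
      (Complex.le_def.mp (posSemidef_conjTranspose_mul_self (H (P x))).trace_nonneg).1
  have htrS : LinearMap.trace ℂ (Matrix (Fin d) (Fin d) ℂ) S = (d * (d * (d + 1) - 1) : ℝ) := by
    rw [hS, trace_isotropicMap, Fintype.card_fin]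
    push_cast
    ring
  have htrG : (LinearMap.trace ℂ (Matrix (Fin d) (Fin d) ℂ) G).re ≤ d := by
    have h := trace_comp_superoperator hG LinearMap.id
    rw [LinearMap.id_comp] at h
    have hd' : (d : ℝ) = ∑ x, τ x := by exact_mod_cast hτsum.symm
    rw [h, Complex.re_sum, hd']
    refine Finset.sum_le_sum fun x _ => ?_
    rw [Complex.re_ofReal_mul, LinearMap.id_apply]
    have := (hPpos x).trace_conjTranspose_mul_self_re_le
    rw [hPtr, Complex.one_re, one_pow] at this
    exact mul_le_of_le_one_right (hτpos x).le this
  have hSSG : (S ∘ₗ S) ∘ₗ G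
      = ((d + 1 : ℝ) ^ 2 : ℂ) • G + isotropicMap (Fin d) 0 (d + 2) := by
    ext1 A
    simp only [hS, LinearMap.comp_apply, LinearMap.add_apply, LinearMap.smul_apply,
      isotropicMap_apply, trace_sub, trace_smul, hGtr, trace_one, Fintype.card_fin, smul_eq_mul]
    push_cast
    module
  have hexpand : (H ∘ₗ H) ∘ₗ G = Ginv - S - Ginv ∘ₗ (S ∘ₗ G) + (S ∘ₗ S) ∘ₗ G := by
    ext1 A
    simp only [hH, LinearMap.comp_apply, LinearMap.add_apply, LinearMap.sub_apply, map_sub, hleft]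
    abel
  have hcyc : LinearMap.trace ℂ (Matrix (Fin d) (Fin d) ℂ) (Ginv ∘ₗ (S ∘ₗ G))
      = LinearMap.trace ℂ (Matrix (Fin d) (Fin d) ℂ) S := by
    rw [LinearMap.trace_comp_comm', LinearMap.comp_assoc]
    congr 1
    ext1 A
    simp [hright]
  have htrace : (LinearMap.trace ℂ (Matrix (Fin d) (Fin d) ℂ) ((H ∘ₗ H) ∘ₗ G)).re
      = (LinearMap.trace ℂ (Matrix (Fin d) (Fin d) ℂ) Ginv).re - 2 * (d * (d * (d + 1) - 1))
        + ((d + 1) ^ 2 * (LinearMap.trace ℂ (Matrix (Fin d) (Fin d) ℂ) G).re - (d + 2) * d) := by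
    have hiso : LinearMap.trace ℂ (Matrix (Fin d) (Fin d) ℂ) (isotropicMap (Fin d) 0 (d + 2))
        = ((-((d + 2) * d) : ℝ) : ℂ) := by
      rw [trace_isotropicMap, Fintype.card_fin]
      push_cast
      ring
    rw [hexpand, hSSG, map_add, map_sub, map_sub, hcyc, htrS, map_add, map_smul, hiso,
      ← Complex.ofReal_pow, smul_eq_mul]
    simp only [Complex.add_re, Complex.sub_re, Complex.re_ofReal_mul, Complex.ofReal_re]
    ring
  have hbound : (LinearMap.trace ℂ (Matrix (Fin d) (Fin d) ℂ) ((H ∘ₗ H) ∘ₗ G)).re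
      ≤ (LinearMap.trace ℂ (Matrix (Fin d) (Fin d) ℂ) Ginv).re - d * (d * (d + 1) - 1) := by
    have := mul_le_mul_of_nonneg_left htrG (sq_nonneg ((d : ℝ) + 1))
    rw [htrace]
    linarith
  have hnonneg : 0 ≤ (LinearMap.trace ℂ (Matrix (Fin d) (Fin d) ℂ) ((H ∘ₗ H) ∘ₗ G)).re := by
    rw [hquad]
    exact Finset.sum_nonneg fun x _ => hterm x
  have hd1 : (d : ℂ) + 1 ≠ 0 := by exact_mod_cast d.succ_ne_zero
  refine ⟨by linarith, fun heq A => ?_, fun hGA => ?_⟩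
  · have hzero : ∑ x, τ x * (trace ((H (P x))ᴴ * H (P x))).re = 0 := by
      rw [← hquad]; linarith
    rw [Finset.sum_eq_zero_iff_of_nonneg fun x _ => hterm x] at hzero
    have hHP : ∀ x, H (P x) = 0 := by
      intro x
      have hre := (mul_eq_zero.mp (hzero x (Finset.mem_univ x))).resolve_left (hτpos x).ne'
      have him := (Complex.le_def.mp
        (posSemidef_conjTranspose_mul_self (H (P x))).trace_nonneg).2
      exact trace_conjTranspose_mul_self_eq_zero_iff.mp (Complex.ext hre him.symm)
    have hHG : H (G A) = 0 := by
      rw [hG, map_sum]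
      exact Finset.sum_eq_zero fun x _ => by rw [map_smul, map_smul, hHP, smul_zero, smul_zero]
    rw [hH, LinearMap.sub_apply, hleft, hS, isotropicMap_apply, hGtr, sub_eq_zero] at hHG
    push_cast at hHG
    rw [one_smul] at hHG
    rw [eq_inv_smul_iff₀ hd1]
    conv_rhs => lhs; rw [hHG]
    abel
  · have hGinvS : Ginv = S := by
      ext1 A
      apply hinj
      rw [hright, hGA, eq_inv_smul_iff₀ hd1, hS, isotropicMap_apply, trace_sub, trace_smul,
        trace_smul, trace_smul, trace_one, Fintype.card_fin]
      simp only [smul_eq_mul]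
      push_cast
      module
    rw [hGinvS, htrS, Complex.ofReal_re]
end

section
/- (Core of Theorem 14: tomographic error bound for any reconstruction) Let F be a finite informationally complete POVM on ℂ^d with τ(x) := tr F(x) > 0 and P(x) := τ(x)⁻¹ • F(x), and let Q : ι → Matrix (Fin d) (Fin d) ℂ be any reconstruction family satisfying ∑_x τ(x) · tr(P(x)ᴴ A) • Q(x) = A for every d×d matrix A. Then ∑_x τ(x) · tr(Q(x)ᴴ Q(x)) ≥ d(d(d+1) − 1), with equality if and only if F is a tight rank-one IC-POVM (i.e. 𝓕(A) = (d+1)⁻¹ • (A + (tr A) • I) for all A) and Q(x) = 𝓕⁻¹(P(x)) for all x. -/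
open Matrix
open scoped ComplexOrder

/-- The trace of the square of a positive semidefinite matrix is at most the square of its trace. -/
lemma Matrix.PosSemidef.trace_mul_self_le {n : Type*} [Fintype n]
    {A : Matrix n n ℂ} (hA : A.PosSemidef) : (A * A).trace ≤ A.trace ^ 2 := by
  have h : ∀ i j, A i j * A j i ≤ A i i * A j j := fun i j => by
    have := (hA.submatrix ![i, j]).det_nonneg
    rw [Matrix.det_fin_two] at this
    simpa using this
  calc (A * A).trace = ∑ i, ∑ j, A i j * A j i := by simp [Matrix.trace, Matrix.mul_apply]
    _ ≤ ∑ i, ∑ j, A i i * A j j := Finset.sum_le_sum fun i _ => Finset.sum_le_sum fun j _ => h i j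
    _ = A.trace ^ 2 := by simp [Matrix.trace, sq, Finset.sum_mul_sum]

/-- The trace of the superoperator `A ↦ ∑ x, τ x • tr((P x)ᴴ A) • B x`, computed in the basis of
matrix units. -/
lemma sum_mul_trace_conjTranspose_mul {n ι : Type*} [Fintype n] [DecidableEq n] [Fintype ι]
    (τ : ι → ℂ) (P B : ι → Matrix n n ℂ) (L : Matrix n n ℂ → Matrix n n ℂ)
    (hL : ∀ A, ∑ x, τ x • (((P x)ᴴ * A).trace • B x) = L A) :
    ∑ x, τ x * ((P x)ᴴ * B x).trace = ∑ i, ∑ j, L (Matrix.single i j 1) i j := by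
  have h : ∀ x i j, ((P x)ᴴ * Matrix.single i j 1).trace = star (P x i j) := fun x i j => by
    simp [Matrix.trace_mul_single]
  simp only [← hL, Matrix.sum_apply, Matrix.smul_apply, smul_eq_mul, h]
  simp_rw [Finset.sum_comm (t := (Finset.univ : Finset ι)), ← Finset.mul_sum]
  refine Finset.sum_congr rfl fun x _ => ?_
  rw [Finset.sum_comm]
  simp [Matrix.trace, Matrix.mul_apply]

/-- Squared Frobenius norm of the difference between `Q` and the inverse frame element
`(d + 1) P - 1` of a tight rank-one POVM. -/
lemma re_trace_sub_smul_sub_one {d : ℕ} (Q P : Matrix (Fin d) (Fin d) ℂ) (hP : P.trace = 1) :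
    ((Q - ((d + 1 : ℂ) • P - 1))ᴴ * (Q - ((d + 1 : ℂ) • P - 1))).trace.re =
      (Qᴴ * Q).trace.re - 2 * ((d + 1) * (Pᴴ * Q).trace.re - Q.trace.re)
        + ((d + 1) ^ 2 * (Pᴴ * P).trace.re - 2 * (d + 1) + d) := by
  have hQP : (Qᴴ * P).trace.re = (Pᴴ * Q).trace.re := by
    rw [← Complex.conj_re, starRingEnd_apply, ← Matrix.trace_conjTranspose]
    simp
  have hreal : ((d : ℂ) + 1) = ((d + 1 : ℝ) : ℂ) := by push_cast; rfl
  simp only [conjTranspose_sub, conjTranspose_smul, conjTranspose_one, hreal, sub_mul,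
    mul_sub, mul_one, one_mul, smul_mul_assoc, mul_smul_comm, trace_sub, trace_smul, smul_eq_mul,
    Complex.sub_re, Complex.re_ofReal_mul, trace_conjTranspose, trace_one, hP, hQP, star_one,
    Complex.star_def, Complex.conj_re, Complex.conj_ofReal, Complex.ofReal_re, Fintype.card_fin, Complex.natCast_re]
  ring

theorem stmt15 {d : ℕ} (hd : 1 ≤ d) {ι : Type*} [Fintype ι]
    (F : ι → Matrix (Fin d) (Fin d) ℂ)
    (hpos : ∀ x, (F x).PosSemidef) (hsum : ∑ x, F x = 1)
    (τ : ι → ℝ) (hτ : ∀ x, (τ x : ℂ) = Matrix.trace (F x)) (hτpos : ∀ x, 0 < τ x)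
    (P : ι → Matrix (Fin d) (Fin d) ℂ) (hP : ∀ x, P x = (τ x)⁻¹ • F x)
    (hIC : ∀ ρ σ : Matrix (Fin d) (Fin d) ℂ,
      ρ.PosSemidef → σ.PosSemidef → Matrix.trace ρ = 1 → Matrix.trace σ = 1 →
      (∀ x, Matrix.trace (F x * ρ) = Matrix.trace (F x * σ)) → ρ = σ)
    (Q : ι → Matrix (Fin d) (Fin d) ℂ)
    (hQ : ∀ A : Matrix (Fin d) (Fin d) ℂ,
      ∑ x, (τ x : ℂ) • (Matrix.trace ((P x)ᴴ * A) • Q x) = A) :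
    (d : ℝ) * ((d : ℝ) * ((d : ℝ) + 1) - 1) ≤
      ∑ x, τ x * (Matrix.trace ((Q x)ᴴ * Q x)).re ∧
    ((∑ x, τ x * (Matrix.trace ((Q x)ᴴ * Q x)).re
        = (d : ℝ) * ((d : ℝ) * ((d : ℝ) + 1) - 1))
      ↔ ((∀ A : Matrix (Fin d) (Fin d) ℂ,
            ∑ x, (τ x : ℂ) • (Matrix.trace ((P x)ᴴ * A) • P x)
              = ((d : ℂ) + 1)⁻¹ • (A + Matrix.trace A • 1)) ∧
          ∀ x, ∑ y, (τ y : ℂ) • (Matrix.trace ((P y)ᴴ * Q x) • P y) = P x)) := by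
  have hd0 : (d : ℂ) + 1 ≠ 0 := by exact_mod_cast d.succ_ne_zero
  have hPpos : ∀ x, (P x).PosSemidef := fun x => by
    rw [hP]; exact (hpos x).smul (inv_nonneg.2 (hτpos x).le)
  have hFP : ∀ x, (τ x : ℂ) • P x = F x := fun x => by
    rw [hP, Complex.coe_smul, smul_inv_smul₀ (hτpos x).ne']
  have hPtr : ∀ x, (P x).trace = 1 := fun x => by
    have h := congrArg Matrix.trace (hFP x)
    rw [trace_smul, ← hτ, smul_eq_mul] at h
    exact mul_left_cancel₀ (Complex.ofReal_ne_zero.2 (hτpos x).ne') (by rw [h, mul_one])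
  have hτsum : ∑ x, τ x = (d : ℝ) := by
    have : ((∑ x, τ x : ℝ) : ℂ) = ((d : ℝ) : ℂ) := by
      push_cast
      simp only [hτ]
      rw [← trace_sum, hsum]; simp
    exact_mod_cast this
  have hPHtr : ∀ x, (P x)ᴴ.trace = 1 := fun x => by rw [trace_conjTranspose, hPtr, star_one]
  have hQtr : ∑ x, τ x * (Q x).trace.re = d := by
    have h := congrArg Matrix.trace (hQ 1)
    simp only [mul_one, hPHtr, one_smul, trace_sum, trace_smul, smul_eq_mul, trace_one,
      Fintype.card_fin] at h
    simpa [Complex.re_sum, Complex.re_ofReal_mul] using congrArg Complex.re h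
  have hPQ : ∑ x, τ x * ((P x)ᴴ * Q x).trace.re = (d : ℝ) ^ 2 := by
    have h := sum_mul_trace_conjTranspose_mul (fun x => (τ x : ℂ)) P Q id hQ
    have h := congrArg Complex.re h
    simpa [Complex.re_sum, Complex.re_ofReal_mul, sq] using h
  have hPP : ∀ x, ((P x)ᴴ * P x).trace.re ≤ 1 := fun x => by
    have h := (hPpos x).trace_mul_self_le
    rw [hPtr] at h
    rw [(hPpos x).isHermitian.eq]
    simpa using (Complex.le_def.1 h).1
  set E := ∑ x, τ x * ((P x)ᴴ * P x).trace.re with hE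
  have hEle : E ≤ d := by
    rw [← hτsum]
    exact Finset.sum_le_sum fun x _ => mul_le_of_le_one_right (hτpos x).le (hPP x)
  set R : ι → Matrix (Fin d) (Fin d) ℂ := fun x => (d + 1 : ℂ) • P x - 1 with hR
  set S := ∑ x, τ x * ((Q x - R x)ᴴ * (Q x - R x)).trace.re with hS
  have hterm : ∀ x, 0 ≤ ((Q x - R x)ᴴ * (Q x - R x)).trace := fun x =>
    (posSemidef_conjTranspose_mul_self _).trace_nonneg
  have hterm' : ∀ x, 0 ≤ τ x * ((Q x - R x)ᴴ * (Q x - R x)).trace.re := fun x =>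
    mul_nonneg (hτpos x).le (Complex.nonneg_iff.1 (hterm x)).1
  have hS0 : 0 ≤ S := Finset.sum_nonneg fun x _ => hterm' x
  have key : ∑ x, τ x * ((Q x)ᴴ * Q x).trace.re
      = (d : ℝ) * (d * (d + 1) - 1) + S + (d + 1) ^ 2 * (d - E) := by
    have : S = ∑ x, τ x * ((Q x)ᴴ * Q x).trace.re
        - 2 * ((d + 1) * ∑ x, τ x * ((P x)ᴴ * Q x).trace.re - ∑ x, τ x * (Q x).trace.re)
        + ((d + 1) ^ 2 * E + (- 2 * (d + 1) + d) * ∑ x, τ x) := by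
      simp only [hS, hE, hR, Finset.mul_sum, ← Finset.sum_add_distrib, ← Finset.sum_sub_distrib]
      refine Finset.sum_congr rfl fun x _ => ?_
      rw [re_trace_sub_smul_sub_one _ _ (hPtr x)]
      ring
    rw [hPQ, hQtr, hτsum] at this
    rw [this]; ring
  have hE0 : 0 ≤ ((d : ℝ) + 1) ^ 2 * (d - E) := mul_nonneg (sq_nonneg _) (sub_nonneg.2 hEle)
  have hpair : ∀ A, ∑ x, (τ x : ℂ) * ((P x)ᴴ * A).trace = A.trace := fun A => by
    have h : ∑ x, (τ x : ℂ) • (P x)ᴴ = 1 := by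
      simp only [(hPpos _).isHermitian.eq, hFP, hsum]
    simpa [Finset.sum_mul, trace_sum, trace_smul] using congrArg (fun M => (M * A).trace) h
  refine ⟨by rw [key]; linarith, fun heq => ?_, fun ⟨htight, hQP⟩ => ?_⟩
  · have hSz : S = 0 := by linarith
    have hQR : ∀ x, Q x = R x := fun x => by
      have h := (Finset.sum_eq_zero_iff_of_nonneg fun x _ => hterm' x).1 hSz x (Finset.mem_univ x)
      have h := (mul_eq_zero.1 h).resolve_left (hτpos x).ne'
      rw [← sub_eq_zero, ← trace_conjTranspose_mul_self_eq_zero_iff]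
      exact Complex.ext h (Complex.nonneg_iff.1 (hterm x)).2.symm
    have htight : ∀ A : Matrix (Fin d) (Fin d) ℂ,
        ∑ x, (τ x : ℂ) • (Matrix.trace ((P x)ᴴ * A) • P x)
          = ((d : ℂ) + 1)⁻¹ • (A + Matrix.trace A • 1) := fun A => by
      rw [eq_inv_smul_iff₀ hd0, ← sub_eq_iff_eq_add, ← hpair A, Finset.smul_sum, Finset.sum_smul,
        ← Finset.sum_sub_distrib]
      conv_rhs => rw [← hQ A]
      refine Finset.sum_congr rfl fun x _ => ?_
      rw [hQR]
      simp only [hR]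
      module
    refine ⟨htight, fun x => ?_⟩
    rw [htight, inv_smul_eq_iff₀ hd0, hQR]
    simp [hR, hPtr]
  · have hQR : ∀ x, Q x = R x := fun x => by
      have h := hQP x
      rw [htight, inv_smul_eq_iff₀ hd0] at h
      have ht := congrArg Matrix.trace h
      simp only [trace_add, trace_smul, hPtr, trace_one, Fintype.card_fin, smul_eq_mul] at ht
      have ht1 : (Q x).trace = 1 := mul_left_cancel₀ hd0 (by linear_combination ht)
      rw [ht1, one_smul] at h
      exact eq_sub_of_add_eq h
    have hSz : S = 0 := by simp [hS, hQR]
    have hEd : E = d := by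
      have h := congrArg Complex.re
        (sum_mul_trace_conjTranspose_mul (fun x => (τ x : ℂ)) P P _ htight)
      have h2 : ∑ i : Fin d, ∑ j : Fin d, (((d : ℂ) + 1)⁻¹ •
          (Matrix.single i j (1 : ℂ) + (Matrix.single i j (1 : ℂ)).trace • 1) :
            Matrix (Fin d) (Fin d) ℂ) i j = d := by
        have : ∀ i j : Fin d, (((d : ℂ) + 1)⁻¹ •
          (Matrix.single i j (1 : ℂ) + (Matrix.single i j (1 : ℂ)).trace • 1) :
            Matrix (Fin d) (Fin d) ℂ) i j = ((d : ℂ) + 1)⁻¹ * (1 + if i = j then 1 else 0) := by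
          intro i j
          rcases eq_or_ne i j with rfl | hij <;> simp [*]
        simp only [this, ← Finset.mul_sum, Finset.sum_add_distrib]
        simp
        field_simp
      rw [h2] at h
      simpa [hE, Complex.re_sum, Complex.re_ofReal_mul] using h
    rw [key, hSz, hEd]; ring
end

section
/- (Theorem 16, upper bound on worst-case cloning fidelity) Let F be a finite POVM on ℂ^d and let ρ̂ : ι → Matrix (Fin d) (Fin d) ℂ be any family of density matrices (the estimate states). Then there exists a unit vector ψ ∈ ℂ^d such that the cloning fidelity satisfies ∑_x tr(F(x) π(ψ)) · tr(ρ̂(x) π(ψ)) ≤ 2/(d+1). -/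
open Matrix
open scoped ComplexOrder

section PhaseVectors

variable {d : ℕ}

/-- The vector whose coordinates are the cube roots of unity with exponents `k`. Together with the
standard basis vectors, these form a weighted complex projective 2-design. -/
noncomputable def phaseVector (k : Fin d → ZMod 3) : EuclideanSpace ℂ (Fin d) :=
  WithLp.toLp 2 fun i => ZMod.stdAddChar (k i)

theorem sum_phase_char (a b c e : Fin d) :
    ∑ k : Fin d → ZMod 3, (ZMod.stdAddChar (k a + k c - k b - k e) : ℂ) =
      if (a = b ∧ c = e) ∨ (a = e ∧ c = b) then (3 : ℂ) ^ d else 0 := by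
  let L : (Fin d → ZMod 3) →+ ZMod 3 :=
    Pi.evalAddMonoidHom (fun _ => ZMod 3) a + Pi.evalAddMonoidHom (fun _ => ZMod 3) c -
      Pi.evalAddMonoidHom (fun _ => ZMod 3) b - Pi.evalAddMonoidHom (fun _ => ZMod 3) e
  let χ : AddChar (Fin d → ZMod 3) ℂ := ZMod.stdAddChar.compAddMonoidHom L
  have hχ : ∀ k, χ k = ZMod.stdAddChar (k a + k c - k b - k e) := fun k => rfl
  simp_rw [← hχ]
  split_ifs with h
  · have : ∀ k, χ k = 1 := by
      intro k
      rw [hχ]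
      rcases h with ⟨rfl, rfl⟩ | ⟨rfl, rfl⟩ <;> simp
    simp [this]
  · refine AddChar.sum_eq_zero_of_ne_one fun h1 => h ?_
    have key : ∀ m : Fin d, (Pi.single m 1 : Fin d → ZMod 3) a + (Pi.single m 1 : _ → ZMod 3) c
        - (Pi.single m 1 : _ → ZMod 3) b - (Pi.single m 1 : _ → ZMod 3) e = 0 := by
      intro m
      apply ZMod.injective_stdAddChar
      rw [← hχ, h1]
      simp
    have ha := key a
    have hc := key c
    simp only [Pi.single_apply] at ha hc
    grind

theorem star_stdAddChar (x : ZMod 3) :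
    (starRingEnd ℂ) (ZMod.stdAddChar x) = ZMod.stdAddChar (-x) :=
  (AddChar.map_neg_eq_conj _ _).symm

theorem trace_mul_proj (A : Matrix (Fin d) (Fin d) ℂ) (v : EuclideanSpace ℂ (Fin d)) :
    (A * proj v).trace = ∑ i, ∑ j, A i j * (v j * (starRingEnd ℂ) (v i)) := by
  simp [Matrix.trace, Matrix.mul_apply, proj]

theorem sum_trace_mul_proj_phaseVector (A B : Matrix (Fin d) (Fin d) ℂ) :
    ∑ k : Fin d → ZMod 3, (A * proj (phaseVector k)).trace * (B * proj (phaseVector k)).trace =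
      3 ^ d * (A.trace * B.trace + (A * B).trace - ∑ i, A i i * B i i) := by
  calc
    _ = ∑ k : Fin d → ZMod 3, ∑ i, ∑ j, ∑ l, ∑ m, A i j * B l m *
        (ZMod.stdAddChar (k j + k m - k i - k l) : ℂ) := by
      refine Finset.sum_congr rfl fun k _ => ?_
      simp_rw [trace_mul_proj, Finset.sum_mul, Finset.mul_sum]
      refine Finset.sum_congr rfl fun i _ => Finset.sum_congr rfl fun j _ =>
        Finset.sum_congr rfl fun l _ => Finset.sum_congr rfl fun m _ => ?_
      simp only [phaseVector, star_stdAddChar, sub_eq_add_neg, AddChar.map_add_eq_mul]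
      ring
    _ = ∑ i, ∑ j, ∑ l, ∑ m, A i j * B l m *
        (if (j = i ∧ m = l) ∨ (j = l ∧ m = i) then (3 : ℂ) ^ d else 0) := by
      simp_rw [← sum_phase_char, Finset.mul_sum]
      rw [Finset.sum_comm]
      refine Finset.sum_congr rfl fun i _ => ?_
      rw [Finset.sum_comm]
      refine Finset.sum_congr rfl fun j _ => ?_
      rw [Finset.sum_comm]
      refine Finset.sum_congr rfl fun l _ => ?_
      rw [Finset.sum_comm]
    _ = ∑ i, ∑ j, ∑ l, ∑ m, 3 ^ d * ((if j = i then if m = l then A i j * B l m else 0 else 0) +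
        (if l = j then if m = i then A i j * B l m else 0 else 0) -
        (if j = i then if l = i then if m = i then A i j * B l m else 0 else 0 else 0)) := by
      refine Finset.sum_congr rfl fun i _ => Finset.sum_congr rfl fun j _ =>
        Finset.sum_congr rfl fun l _ => Finset.sum_congr rfl fun m _ => ?_
      split_ifs <;> first | ring1 | grind
    _ = _ := by
      simp_rw [← Finset.mul_sum, Finset.sum_sub_distrib, Finset.sum_add_distrib]
      congr 2
      · congr 1
        · simp [Matrix.trace, Finset.sum_mul_sum]
        · simp [Matrix.trace, Matrix.mul_apply]
      · refine Finset.sum_congr rfl fun i _ => ?_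
        simp

theorem trace_mul_proj_single (A : Matrix (Fin d) (Fin d) ℂ) (i : Fin d) :
    (A * proj (EuclideanSpace.single i 1)).trace = A i i := by
  simp [trace_mul_proj]

theorem norm_phaseVector (k : Fin d → ZMod 3) : ‖phaseVector k‖ = √d := by
  simp [EuclideanSpace.norm_eq, phaseVector]

theorem proj_smul (r : ℝ) (v : EuclideanSpace ℂ (Fin d)) :
    proj ((r : ℂ) • v) = (r ^ 2) • proj v := by
  ext i j
  simp [proj]
  ring

end PhaseVectors

namespace Matrix.PosSemidef

variable {n : Type*} [Fintype n]

theorem im_trace_mul_eq_zero {A B : Matrix n n ℂ} (hA : A.PosSemidef) (hB : B.PosSemidef) :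
    (A * B).trace.im = 0 := by
  rw [← Complex.conj_eq_iff_im, starRingEnd_apply, ← Matrix.trace_conjTranspose,
    Matrix.conjTranspose_mul, hA.1.eq, hB.1.eq, Matrix.trace_mul_comm]

open scoped MatrixOrder in
theorem exists_eq_conjTranspose_mul_self {A : Matrix n n ℂ} (hA : A.PosSemidef) :
    ∃ M : Matrix n n ℂ, A = Mᴴ * M := by
  classical
  exact CStarAlgebra.nonneg_iff_eq_star_mul_self.mp hA.nonneg

open scoped Matrix.Norms.Frobenius in
theorem re_trace_mul_le {A B : Matrix n n ℂ} (hA : A.PosSemidef) (hB : B.PosSemidef) :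
    (A * B).trace.re ≤ A.trace.re * B.trace.re := by
  classical
  have key : ∀ M : Matrix n n ℂ, (Mᴴ * M).trace.re = ‖M‖ ^ 2 := by
    intro M
    rw [Matrix.frobenius_norm_def, ← Real.sqrt_eq_rpow, Real.sq_sqrt (by positivity),
      Finset.sum_comm]
    simp [Matrix.trace, Matrix.mul_apply, ← Complex.normSq_eq_norm_sq, Complex.normSq_apply]
  obtain ⟨M, rfl⟩ := exists_eq_conjTranspose_mul_self hA
  obtain ⟨N, rfl⟩ := exists_eq_conjTranspose_mul_self hB
  have h : (Mᴴ * M * (Nᴴ * N)).trace = ((M * Nᴴ)ᴴ * (M * Nᴴ)).trace := by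
    rw [← Matrix.mul_assoc, Matrix.trace_mul_comm]
    simp [Matrix.mul_assoc]
  rw [h, key, key, key, ← mul_pow]
  gcongr
  calc ‖M * Nᴴ‖ ≤ ‖M‖ * ‖Nᴴ‖ := Matrix.frobenius_norm_mul _ _
    _ = ‖M‖ * ‖N‖ := by rw [Matrix.frobenius_norm_conjTranspose]

end Matrix.PosSemidef

theorem posSemidef_proj {d : ℕ} (v : EuclideanSpace ℂ (Fin d)) : (proj v).PosSemidef :=
  Matrix.posSemidef_vecMulVec_self_star (v : Fin d → ℂ)

theorem sum_re_trace_mul_proj_le {d : ℕ} {A B : Matrix (Fin d) (Fin d) ℂ}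
    (hA : A.PosSemidef) (hB : B.PosSemidef) :
    ∑ k : Fin d → ZMod 3,
        (A * proj (phaseVector k)).trace.re * (B * proj (phaseVector k)).trace.re +
      3 ^ d * ∑ i, (A * proj (EuclideanSpace.single i 1)).trace.re *
        (B * proj (EuclideanSpace.single i 1)).trace.re ≤
      3 ^ d * (2 * (A.trace.re * B.trace.re)) := by
  have hre : ∀ v, (A * proj v).trace.re * (B * proj v).trace.re =
      ((A * proj v).trace * (B * proj v).trace).re := fun v => by
    rw [Complex.mul_re, hA.im_trace_mul_eq_zero (posSemidef_proj v)]
    simp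
  have htr : A.trace.re * B.trace.re = (A.trace * B.trace).re := by
    have := hA.im_trace_mul_eq_zero Matrix.PosSemidef.one
    rw [Matrix.mul_one] at this
    rw [Complex.mul_re, this]
    simp
  have h3 : ∀ z : ℂ, (3 ^ d * z).re = 3 ^ d * z.re := fun z => by
    exact_mod_cast Complex.re_ofReal_mul (3 ^ d) z
  have hle := hA.re_trace_mul_le hB
  simp_rw [hre]
  rw [← Complex.re_sum, ← Complex.re_sum, sum_trace_mul_proj_phaseVector, h3]
  simp_rw [trace_mul_proj_single]
  rw [← mul_add]
  gcongr
  simp only [Complex.sub_re, Complex.add_re]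
  linarith

theorem stmt16 {d : ℕ} (hd : 1 ≤ d) {ι : Type*} [Fintype ι]
    (F : ι → Matrix (Fin d) (Fin d) ℂ)
    (hpos : ∀ x, (F x).PosSemidef) (hsum : ∑ x, F x = 1)
    (ρhat : ι → Matrix (Fin d) (Fin d) ℂ)
    (hρ : ∀ x, (ρhat x).PosSemidef ∧ Matrix.trace (ρhat x) = 1) :
    ∃ ψ : EuclideanSpace ℂ (Fin d), ‖ψ‖ = 1 ∧
      ∑ x, (Matrix.trace (F x * proj ψ)).re * (Matrix.trace (ρhat x * proj ψ)).re
        ≤ 2 / ((d : ℝ) + 1) := by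
  by_contra! hcon
  have hd0 : (0 : ℝ) < d := by exact_mod_cast hd
  set f : EuclideanSpace ℂ (Fin d) → ℝ := fun ψ =>
    ∑ x, (Matrix.trace (F x * proj ψ)).re * (Matrix.trace (ρhat x * proj ψ)).re with hf
  have hphase : ∀ k, 2 / ((d : ℝ) + 1) * d ^ 2 < f (phaseVector k) := by
    intro k
    have hs : √(d : ℝ) ^ 2 = d := Real.sq_sqrt hd0.le
    have h := hcon ((((√d)⁻¹ : ℝ) : ℂ) • phaseVector k) (by
      rw [norm_smul, norm_phaseVector, Complex.norm_real, Real.norm_of_nonneg (by positivity)]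
      exact inv_mul_cancel₀ (by positivity))
    have hscale : ∑ x, (Matrix.trace (F x * proj ((((√d)⁻¹ : ℝ) : ℂ) • phaseVector k))).re *
        (Matrix.trace (ρhat x * proj ((((√d)⁻¹ : ℝ) : ℂ) • phaseVector k))).re =
        f (phaseVector k) / d ^ 2 := by
      simp only [hf, proj_smul, inv_pow, hs, Matrix.mul_smul, Matrix.trace_smul, Complex.smul_re,
        smul_eq_mul, Finset.sum_div]
      refine Finset.sum_congr rfl fun x _ => ?_
      field_simp
    rw [hscale, lt_div_iff₀ (by positivity)] at h
    exact h
  have hbasis : ∀ i, 2 / ((d : ℝ) + 1) < f (EuclideanSpace.single i 1) :=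
    fun i => hcon _ (by simp)
  have h1 : (3 : ℝ) ^ d * (2 / ((d : ℝ) + 1) * d ^ 2) < ∑ k, f (phaseVector k) := by
    calc _ = ∑ _k : Fin d → ZMod 3, 2 / ((d : ℝ) + 1) * d ^ 2 := by simp
      _ < _ := Finset.sum_lt_sum_of_nonempty Finset.univ_nonempty fun k _ => hphase k
  have h2 : d * (2 / ((d : ℝ) + 1)) ≤ ∑ i, f (EuclideanSpace.single i 1) := by
    calc _ = ∑ _i : Fin d, 2 / ((d : ℝ) + 1) := by simp
      _ ≤ _ := Finset.sum_le_sum fun i _ => (hbasis i).le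
  have h3 : ∑ k, f (phaseVector k) + 3 ^ d * ∑ i, f (EuclideanSpace.single i 1) ≤
      3 ^ d * (2 * d) := by
    have htr : ∑ x, (F x).trace.re = d := by
      rw [← Complex.re_sum, ← Matrix.trace_sum, hsum]
      simp
    have h := Finset.sum_le_sum fun x (_ : x ∈ Finset.univ) =>
      sum_re_trace_mul_proj_le (hpos x) (hρ x).1
    simp only [(hρ _).2, Complex.one_re, mul_one, Finset.sum_add_distrib, ← Finset.mul_sum,
      htr] at h
    simp only [hf]
    rw [Finset.sum_comm, Finset.sum_comm (s := (Finset.univ : Finset (Fin d)))]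
    exact h
  have h4 : (3 : ℝ) ^ d * (2 / ((d : ℝ) + 1) * d ^ 2) + 3 ^ d * (d * (2 / ((d : ℝ) + 1))) =
      3 ^ d * (2 * d) := by
    field_simp
  have h5 := mul_le_mul_of_nonneg_left h2 (show (0 : ℝ) ≤ 3 ^ d by positivity)
  linarith
end
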